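/- Let X be a proper geodesic metric space that is δ-hyperbolic for some δ ≥ 0, and let γ, γ' : ℕ → X be quasigeodesic rays such that the images γ(ℕ) and γ'(ℕ) are close (γ(ℕ) ≍ γ'(ℕ)). Then the images are at finite Hausdorff distance: there exists T ≥ 0 such that for every n there is m with d(γ(n), γ'(m)) ≤ T, and for every m there is n with d(γ'(m), γ(n)) ≤ T. -/

import Mathlib

open Topology

/-- A subset `E ⊆ X × X` is an entourage if `sup_{(x,y) ∈ E} d(x,y) < ∞`. -/
def IsEntourage {X : Type*} [MetricSpace X] (E : Set (X × X)) : Prop :=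
  ∃ C : ℝ, ∀ p ∈ E, dist p.1 p.2 ≤ C

/-- `E[S] = {x | ∃ y ∈ S, (x,y) ∈ E}`. -/
def EImage {X : Type*} (E : Set (X × X)) (S : Set X) : Set X :=
  {x | ∃ y ∈ S, (x, y) ∈ E}

/-- Subsets `A, B` are close (`A ≍ B`): there are `R ≥ 0` and a sequence
`(aₙ, bₙ) ∈ A × B` with `d(aₙ, bₙ) ≤ R` and `{aₙ}` unbounded. -/
def Close {X : Type*} [MetricSpace X] (A B : Set X) : Prop :=
  ∃ R : ℝ, 0 ≤ R ∧ ∃ a b : ℕ → X, (∀ n, a n ∈ A) ∧ (∀ n, b n ∈ B) ∧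
    (∀ n, dist (a n) (b n) ≤ R) ∧ ¬ Bornology.IsBounded (Set.range a)

/-- `A ≍_f B` iff there do not exist `A' ⊇ A`, `B' ⊇ B` with `A' ∪ B' = X` and `¬(A' ≍ B')`. -/
def CloseF {X : Type*} [MetricSpace X] (A B : Set X) : Prop :=
  ¬ ∃ A' B' : Set X, A ⊆ A' ∧ B ⊆ B' ∧ A' ∪ B' = Set.univ ∧ ¬ Close A' B'

/-- A large-scale proximity relation. -/
structure IsLSP {X : Type*} [MetricSpace X] (r : Set X → Set X → Prop) : Prop where
  not_self_iff_bounded : ∀ B : Set X, (¬ r B B) ↔ Bornology.IsBounded B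
  symm : ∀ A B : Set X, r A B → r B A
  entourage_invariant : ∀ (A A' : Set X) (E : Set (X × X)), IsEntourage E →
    A' ⊆ EImage E A → A ⊆ EImage E A' → ∀ B : Set X, r A B → r A' B
  union_iff : ∀ A B C : Set X, r (A ∪ B) C ↔ (r A C ∨ r B C)
  separation : ∀ A B : Set X, ¬ r A B →
    ∃ C D : Set X, C ∪ D = Set.univ ∧ ¬ r C A ∧ ¬ r D B

/-- An `r`-ultrafilter on `X`. -/
def IsRUltrafilter {X : Type*} (r : Set X → Set X → Prop) (F : Set (Set X)) : Prop :=
  (∀ A ∈ F, ∀ B ∈ F, r A B) ∧ (∀ A B : Set X, A ∪ B ∈ F → A ∈ F ∨ B ∈ F) ∧ Set.univ ∈ F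

/-- A compactification `i : X → X̄` is coarse if for every entourage `E`, the closure of
`(i × i)(E)` meets `(∂X × X̄) ∪ (X̄ × ∂X)` only inside the diagonal over `∂X = X̄ ∖ i(X)`. -/
def IsCoarseCompactification {X Xb : Type*} [MetricSpace X] [TopologicalSpace Xb]
    (i : X → Xb) : Prop :=
  ∀ E : Set (X × X), IsEntourage E →
    closure ((fun p : X × X => (i p.1, i p.2)) '' E) ∩
      (((Set.range i)ᶜ ×ˢ (Set.univ : Set Xb)) ∪ ((Set.univ : Set Xb) ×ˢ (Set.range i)ᶜ)) ⊆
      {q : Xb × Xb | q.1 = q.2 ∧ q.1 ∈ (Set.range i)ᶜ}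

/-- A Higson function: bounded, continuous, and for every entourage `E` and `ε > 0`
there is a bounded set `B` outside of which the variation on `E` is `< ε`. -/
def IsHigson {X : Type*} [MetricSpace X] (φ : X → ℝ) : Prop :=
  Continuous φ ∧ (∃ C : ℝ, ∀ x, |φ x| ≤ C) ∧
  ∀ E : Set (X × X), IsEntourage E → ∀ ε > (0:ℝ), ∃ B : Set X, Bornology.IsBounded B ∧
    ∀ p ∈ E, (p.1 ∉ B ∨ p.2 ∉ B) → |φ p.1 - φ p.2| < ε

/-- A coarse map: coarsely uniform and coarsely proper. -/
def IsCoarseMap {X Y : Type*} [MetricSpace X] [MetricSpace Y] (f : X → Y) : Prop :=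
  (∀ E : Set (X × X), IsEntourage E →
    IsEntourage ((fun p : X × X => (f p.1, f p.2)) '' E)) ∧
  (∀ S : Set Y, Bornology.IsBounded S → Bornology.IsBounded (f ⁻¹' S))

/-- The Gromov product `(x|y)_w`. -/
noncomputable def gromovProd {X : Type*} [MetricSpace X] (w x y : X) : ℝ :=
  (dist x w + dist y w - dist x y) / 2

/-- `X` is a geodesic metric space. -/
def IsGeodesicSpace (X : Type*) [MetricSpace X] : Prop :=
  ∀ x y : X, ∃ γ : ℝ → X, γ 0 = x ∧ γ (dist x y) = y ∧
    ∀ s ∈ Set.Icc (0:ℝ) (dist x y), ∀ t ∈ Set.Icc (0:ℝ) (dist x y),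
      dist (γ s) (γ t) = |s - t|

theorem gromovProd_comm {X : Type*} [MetricSpace X] (w x y : X) :
    gromovProd w x y = gromovProd w y x := by
  unfold gromovProd
  rw [dist_comm x y]
  ring

/-- The four-point condition defining `δ`-hyperbolicity. -/
def IsGromovHyperbolic (X : Type*) [MetricSpace X] (δ : ℝ) : Prop :=
  ∀ w x y z : X, gromovProd w x y ≥ min (gromovProd w x z) (gromovProd w z y) - δ

/-- The inequalities defining a quasigeodesic ray with constants `R` and `S`. -/
def IsQuasigeodesicRay {X : Type*} [MetricSpace X] (R S : ℝ) (p : ℕ → X) : Prop :=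
  ∀ i j : ℕ, |(i : ℝ) - (j : ℝ)| / R - S ≤ dist (p i) (p j) ∧
    dist (p i) (p j) ≤ R * |(i : ℝ) - (j : ℝ)| + S

/-- `g` restricted to `[0, ℓ]` is a geodesic segment. -/
def IsGeodesicOn {X : Type*} [MetricSpace X] (g : ℝ → X) (ℓ : ℝ) : Prop :=
  ∀ s ∈ Set.Icc (0 : ℝ) ℓ, ∀ t ∈ Set.Icc (0 : ℝ) ℓ, dist (g s) (g t) = |s - t|

theorem IsGeodesicOn.continuousOn {X : Type*} [MetricSpace X] {g : ℝ → X} {ℓ : ℝ}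
    (hg : IsGeodesicOn g ℓ) : ContinuousOn g (Set.Icc 0 ℓ) := by
  rw [Metric.continuousOn_iff]
  intro t ht ε hε
  refine ⟨ε, hε, fun s hs hst => ?_⟩
  rwa [hg s hs t ht, ← Real.dist_eq]

theorem IsQuasigeodesicRay.abs_sub_le {X : Type*} [MetricSpace X] {R S : ℝ} {p : ℕ → X}
    (hp : IsQuasigeodesicRay R S p) (hR : 0 < R) {i j : ℕ} {c : ℝ}
    (h : dist (p i) (p j) ≤ c) : |(i : ℝ) - (j : ℝ)| ≤ R * (c + S) := by
  have h1 : |(i : ℝ) - (j : ℝ)| / R ≤ c + S := by linarith [(hp i j).1]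
  rw [div_le_iff₀ hR] at h1
  linarith

/-- Along a chain of at most `2 ^ n` steps the Gromov product drops by at most `n * δ`. -/
theorem IsGromovHyperbolic.le_gromovProd_of_chain {X : Type*} [MetricSpace X] {δ : ℝ}
    (hX : IsGromovHyperbolic X δ) (p : ℕ → X) (w : X) (c : ℝ) (n : ℕ) :
    ∀ i k : ℕ, k ≤ 2 ^ n → (∀ j, i ≤ j → j ≤ i + k → c ≤ gromovProd w (p j) (p j)) →
      (∀ j, i ≤ j → j < i + k → c ≤ gromovProd w (p j) (p (j + 1))) →
      c - n * δ ≤ gromovProd w (p i) (p (i + k)) := by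
  induction n with
  | zero =>
    intro i k hk h0 h1
    obtain rfl | rfl : k = 0 ∨ k = 1 := by rw [pow_zero] at hk; omega
    · simpa using h0 i le_rfl le_rfl
    · simpa using h1 i le_rfl (by omega)
  | succ n ih =>
    intro i k hk h0 h1
    rw [pow_succ] at hk
    obtain ⟨a, b, rfl, ha, hb⟩ : ∃ a b, k = a + b ∧ a ≤ 2 ^ n ∧ b ≤ 2 ^ n :=
      ⟨k / 2, k - k / 2, by omega, by omega, by omega⟩
    have hA := ih i a ha (fun j hj hj' => h0 j hj (by omega))
      (fun j hj hj' => h1 j hj (by omega))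
    have hB := ih (i + a) b hb (fun j hj hj' => h0 j (by omega) (by omega))
      (fun j hj hj' => h1 j (by omega) (by omega))
    have h := hX w (p i) (p (i + a + b)) (p (i + a))
    have hmin := le_min hA hB
    rw [← add_assoc]
    push_cast
    linarith

theorem exists_bound_of_two_pow_le (a b : ℝ) :
    ∃ n₀ : ℕ, ∀ n : ℕ, (2 : ℝ) ^ n ≤ a * n + b → n ≤ n₀ := by
  have h1 : (fun n : ℕ => a * (n : ℝ) + b) =o[Filter.atTop] fun n : ℕ => (2 : ℝ) ^ n := by
    refine Asymptotics.IsLittleO.add ?_ ?_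
    · simpa using (isLittleO_pow_const_const_pow_of_one_lt (R := ℝ) 1
        (one_lt_two : (1 : ℝ) < 2)).const_mul_left a
    · simpa using (isLittleO_pow_const_const_pow_of_one_lt (R := ℝ) 0
        (one_lt_two : (1 : ℝ) < 2)).const_mul_left b
  obtain ⟨n₀, hn₀⟩ := Filter.eventually_atTop.1 (h1.def (c := 1 / 2) (by norm_num))
  refine ⟨n₀, fun n hn => ?_⟩
  by_contra! hlt
  have h2 := hn₀ n hlt.le
  have hpos : (0 : ℝ) < 2 ^ n := by positivity
  rw [Real.norm_eq_abs, Real.norm_of_nonneg hpos.le] at h2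
  linarith [le_abs_self (a * (n : ℝ) + b)]

/-- A geodesic point at distance `2 * D` from `g t₀`, or an endpoint nearer than that, has a nearby
path point such that the Gromov product of the two seen from `g t₀` is at least `D - C`. -/
theorem exists_near_le_gromovProd {X : Type*} [MetricSpace X] {g : ℝ → X} {ℓ D C : ℝ} {p : ℕ → X} {N : ℕ}
    (hg : IsGeodesicOn g ℓ) (hD : 0 ≤ D) (hC : 0 ≤ C) {t₀ e s : ℝ} (ht₀ : t₀ ∈ Set.Icc 0 ℓ)
    (hs : s ∈ Set.Icc 0 ℓ) {k : ℕ} (hk : k ≤ N) (he : dist (g e) (p k) ≤ C)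
    (hcase : |s - t₀| = 2 * D ∨ (s = e ∧ |s - t₀| ≤ 2 * D))
    (hnear : ∀ t ∈ Set.Icc 0 ℓ, ∃ j ≤ N, dist (g t) (p j) ≤ D)
    (hfar : ∀ j ≤ N, D ≤ dist (g t₀) (p j)) :
    ∃ j ≤ N, dist (g s) (p j) ≤ D + C ∧ D - C ≤ gromovProd (g t₀) (g s) (p j) := by
  unfold gromovProd
  have hd := hg s hs t₀ ht₀
  rcases hcase with h | ⟨rfl, h⟩
  · obtain ⟨j, hj, hj'⟩ := hnear s hs
    have := hfar j hj
    rw [dist_comm] at this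
    exact ⟨j, hj, by linarith, by linarith⟩
  · refine ⟨k, hk, by linarith, ?_⟩
    have h1 := hfar k hk
    have h2 := dist_triangle_left (g t₀) (p k) (g s)
    rw [dist_comm (p k) (g t₀)]
    linarith

/-- A geodesic lies in a uniform neighbourhood of any quasigeodesic whose endpoints are near
those of the geodesic. -/
theorem exists_forall_geodesic_near_quasigeodesic {X : Type*} [MetricSpace X] {δ : ℝ}
    (hδ : 0 ≤ δ) (hX : IsGromovHyperbolic X δ) {R S C : ℝ} (hR : 0 < R) (hS : 0 ≤ S)
    (hC : 0 ≤ C) :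
    ∃ T : ℝ, 0 ≤ T ∧ ∀ (g : ℝ → X) (ℓ : ℝ) (p : ℕ → X) (N : ℕ), 0 ≤ ℓ → IsGeodesicOn g ℓ →
      IsQuasigeodesicRay R S p → dist (g 0) (p 0) ≤ C → dist (g ℓ) (p N) ≤ C →
      ∀ t ∈ Set.Icc 0 ℓ, ∃ j ≤ N, dist (g t) (p j) ≤ T := by
  obtain ⟨n₀, hn₀⟩ := exists_bound_of_two_pow_le (6 * R * δ)
    (R * (6 * (C + (R + S) + 3 * δ) + 2 * C + S) + 1)
  refine ⟨C + (R + S) + 3 * δ + n₀ * δ, by positivity, fun g ℓ p N hℓ hg hp h0 hN => ?_⟩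
  set A : Set X := p '' Set.Iic N
  have hAne : A.Nonempty := ⟨p 0, 0, Nat.zero_le N, rfl⟩
  have hAc : IsCompact A := ((Set.finite_Iic N).image p).isCompact
  obtain ⟨t₀, ht₀, hmax⟩ := isCompact_Icc.exists_isMaxOn (Set.nonempty_Icc.2 hℓ)
    ((Metric.continuous_infDist_pt A).comp_continuousOn hg.continuousOn)
  obtain ⟨D, hDdef⟩ : ∃ D, D = Metric.infDist (g t₀) A := ⟨_, rfl⟩
  have hD : 0 ≤ D := hDdef ▸ Metric.infDist_nonneg
  have hnear : ∀ t ∈ Set.Icc 0 ℓ, ∃ j ≤ N, dist (g t) (p j) ≤ D := by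
    intro t ht
    obtain ⟨_, ⟨j, hj, rfl⟩, hj'⟩ := hAc.exists_infDist_eq_dist hAne (g t)
    exact ⟨j, hj, by rw [← hj', hDdef]; exact hmax ht⟩
  have hfar : ∀ j ≤ N, D ≤ dist (g t₀) (p j) := fun j hj =>
    hDdef ▸ Metric.infDist_le_dist_of_mem ⟨j, hj, rfl⟩
  suffices hDT : D ≤ C + (R + S) + 3 * δ + n₀ * δ by
    intro t ht
    obtain ⟨j, hj, hj'⟩ := hnear t ht
    exact ⟨j, hj, hj'.trans hDT⟩
  obtain ⟨s, hs, hst, hscase⟩ : ∃ s ∈ Set.Icc 0 ℓ, s ≤ t₀ ∧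
      (|s - t₀| = 2 * D ∨ (s = 0 ∧ |s - t₀| ≤ 2 * D)) := by
    obtain ⟨ht1, ht2⟩ := ht₀
    rcases le_total (2 * D) t₀ with h | h
    · exact ⟨t₀ - 2 * D, ⟨by linarith, by linarith⟩, by linarith,
        Or.inl (by rw [abs_of_nonpos] <;> linarith)⟩
    · exact ⟨0, ⟨le_rfl, hℓ⟩, ht1, Or.inr ⟨rfl, by rw [abs_of_nonpos] <;> linarith⟩⟩
  obtain ⟨u, hu, hut, hucase⟩ : ∃ u ∈ Set.Icc 0 ℓ, t₀ ≤ u ∧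
      (|u - t₀| = 2 * D ∨ (u = ℓ ∧ |u - t₀| ≤ 2 * D)) := by
    obtain ⟨ht1, ht2⟩ := ht₀
    rcases le_total (t₀ + 2 * D) ℓ with h | h
    · exact ⟨t₀ + 2 * D, ⟨by linarith, by linarith⟩, by linarith,
        Or.inl (by rw [abs_of_nonneg] <;> linarith)⟩
    · exact ⟨ℓ, ⟨hℓ, le_rfl⟩, ht2, Or.inr ⟨rfl, by rw [abs_of_nonneg] <;> linarith⟩⟩
  obtain ⟨j₁, hj₁, hd₁, hG₁⟩ :=
    exists_near_le_gromovProd hg hD hC ht₀ hs (Nat.zero_le N) h0 hscase hnear hfar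
  obtain ⟨j₂, hj₂, hd₂, hG₂⟩ := exists_near_le_gromovProd hg hD hC ht₀ hu le_rfl hN hucase hnear hfar
  have hs2 : |s - t₀| ≤ 2 * D := hscase.elim le_of_eq And.right
  have hu2 : |u - t₀| ≤ 2 * D := hucase.elim le_of_eq And.right
  have hG0 : gromovProd (g t₀) (g s) (g u) = 0 := by
    unfold gromovProd
    rw [hg s hs t₀ ht₀, hg u hu t₀ ht₀, hg s hs u hu, abs_of_nonpos (by linarith : s - t₀ ≤ 0),
      abs_of_nonneg (by linarith : 0 ≤ u - t₀), abs_of_nonpos (by linarith : s - u ≤ 0)]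
    ring
  have hd : dist (p j₁) (p j₂) ≤ 6 * D + 2 * C := by
    have h1 := dist_triangle4 (p j₁) (g s) (g u) (p j₂)
    have h2 := dist_triangle_right (g s) (g u) (g t₀)
    rw [hg s hs t₀ ht₀, hg u hu t₀ ht₀] at h2
    rw [dist_comm (p j₁) (g s)] at h1
    linarith
  have hM := hp.abs_sub_le hR hd
  obtain ⟨m, hm1, hm2⟩ := exists_nat_pow_near
    (by linarith [abs_nonneg ((j₁ : ℝ) - j₂)] : 1 ≤ |(j₁ : ℝ) - j₂| + 1)
    (one_lt_two : (1 : ℝ) < 2)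
  have hself : ∀ j ≤ N, D - (R + S) ≤ gromovProd (g t₀) (p j) (p j) := by
    intro j hj
    have := hfar j hj
    rw [dist_comm] at this
    unfold gromovProd
    rw [dist_self]
    linarith
  have hstep : ∀ j, j + 1 ≤ N → D - (R + S) ≤ gromovProd (g t₀) (p j) (p (j + 1)) := by
    intro j hj
    have h1 := hfar j (by omega)
    have h2 := hfar (j + 1) hj
    have h3 := (hp j (j + 1)).2
    rw [dist_comm] at h1 h2
    have h4 : |(j : ℝ) - ((j + 1 : ℕ) : ℝ)| = 1 := by
      push_cast
      rw [abs_of_nonpos] <;> linarith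
    rw [h4] at h3
    unfold gromovProd
    linarith
  have key : ∀ a b : ℕ, a ≤ b → b ≤ N → |(a : ℝ) - b| + 1 < 2 ^ (m + 1) →
      D - (R + S) - (m + 1 : ℕ) * δ ≤ gromovProd (g t₀) (p a) (p b) := by
    intro a b hab hb hlt
    obtain ⟨k, rfl⟩ := Nat.exists_eq_add_of_le hab
    refine hX.le_gromovProd_of_chain p (g t₀) _ (m + 1) a k ?_
      (fun j _ hj => hself j (by omega)) (fun j _ hj => hstep j (by omega))
    have h1 : |(a : ℝ) - ((a + k : ℕ) : ℝ)| = k := by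
      push_cast
      rw [sub_add_cancel_left, abs_neg, Nat.abs_cast]
    rw [h1] at hlt
    have h2 : (k : ℝ) ≤ ((2 ^ (m + 1) : ℕ) : ℝ) := by
      push_cast
      linarith
    exact_mod_cast h2
  have hmid : D - (R + S) - (m + 1 : ℕ) * δ ≤ gromovProd (g t₀) (p j₁) (p j₂) := by
    rcases le_total j₁ j₂ with h | h
    · exact key j₁ j₂ h hj₂ hm2
    · rw [gromovProd_comm]
      exact key j₂ j₁ h hj₁ (by rwa [abs_sub_comm])
  have hDm : D ≤ C + (R + S) + 3 * δ + m * δ := by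
    have h1 := hX (g t₀) (g s) (g u) (p j₁)
    have h2 := hX (g t₀) (p j₁) (g u) (p j₂)
    rw [gromovProd_comm] at hG₂
    push_cast at hmid
    have hmδ : 0 ≤ m * δ := by positivity
    have h3 : D - C - (R + S) - (m + 1) * δ ≤
        min (gromovProd (g t₀) (p j₁) (p j₂)) (gromovProd (g t₀) (p j₂) (g u)) :=
      le_min (by linarith) (by linarith)
    have h4 : D - C - (R + S) - (m + 1) * δ - δ ≤
        min (gromovProd (g t₀) (g s) (p j₁)) (gromovProd (g t₀) (p j₁) (g u)) :=
      le_min (by linarith) (by linarith)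
    linarith
  have hmn : (m : ℝ) ≤ n₀ := by
    refine Nat.cast_le.2 (hn₀ m ?_)
    have := mul_le_mul_of_nonneg_left hDm hR.le
    linarith
  have := mul_le_mul_of_nonneg_right hmn hδ
  linarith

/-- Stability of quasigeodesics: a quasigeodesic lies in a uniform neighbourhood of a geodesic
with nearby endpoints. -/
theorem exists_forall_quasigeodesic_near_geodesic {X : Type*} [MetricSpace X] {δ : ℝ}
    (hδ : 0 ≤ δ) (hX : IsGromovHyperbolic X δ) {R S C : ℝ} (hR : 0 < R) (hS : 0 ≤ S)
    (hC : 0 ≤ C) :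
    ∃ T : ℝ, 0 ≤ T ∧ ∀ (g : ℝ → X) (ℓ : ℝ) (p : ℕ → X) (N : ℕ), 0 ≤ ℓ → IsGeodesicOn g ℓ →
      IsQuasigeodesicRay R S p → dist (g 0) (p 0) ≤ C → dist (g ℓ) (p N) ≤ C →
      ∀ i ≤ N, ∃ t ∈ Set.Icc 0 ℓ, dist (p i) (g t) ≤ T := by
  obtain ⟨D₀, hD₀, hD₀'⟩ := exists_forall_geodesic_near_quasigeodesic hδ hX hR hS hC
  obtain ⟨D, hD, hCD, hDD⟩ : ∃ D, 0 ≤ D ∧ C ≤ D ∧ D₀ ≤ D :=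
    ⟨max C D₀, hC.trans (le_max_left _ _), le_max_left _ _, le_max_right _ _⟩
  refine ⟨R * (R * (2 * D + 1 + S)) + S + D, by positivity,
    fun g ℓ p N hℓ hg hp h0 hN i hi => ?_⟩
  have hcover : ∀ t ∈ Set.Icc 0 ℓ, ∃ j ≤ N, dist (g t) (p j) ≤ D := fun t ht => by
    obtain ⟨j, hj, hj'⟩ := hD₀' g ℓ p N hℓ hg hp h0 hN t ht
    exact ⟨j, hj, hj'.trans hDD⟩
  obtain ⟨s, hs, u, hu, hsu, ⟨j, hji, hj⟩, k, hik, hk⟩ : ∃ s ∈ Set.Icc 0 ℓ, ∃ u ∈ Set.Icc 0 ℓ,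
      |s - u| ≤ 1 ∧ (∃ j ≤ i, dist (g s) (p j) ≤ D) ∧ ∃ k, i ≤ k ∧ dist (g u) (p k) ≤ D := by
    by_contra! hcon
    have hmem : ∀ m : ℕ, min (m : ℝ) ℓ ∈ Set.Icc 0 ℓ := fun m =>
      ⟨le_min (Nat.cast_nonneg m) hℓ, min_le_right _ _⟩
    have hall : ∀ m : ℕ, ∃ j ≤ i, dist (g (min (m : ℝ) ℓ)) (p j) ≤ D := by
      intro m
      induction m with
      | zero => exact ⟨0, Nat.zero_le i, by simpa [hℓ] using h0.trans hCD⟩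
      | succ m ih =>
        obtain ⟨j, hj, hj'⟩ := hcover _ (hmem (m + 1))
        refine ⟨j, ?_, hj'⟩
        by_contra! hij
        refine absurd hj' (not_le.2 (hcon _ (hmem m) _ (hmem (m + 1)) ?_ ih j hij.le))
        refine (abs_min_sub_min_le_max _ _ _ _).trans ?_
        simp
    obtain ⟨m, hm⟩ := exists_nat_ge ℓ
    have h := hall m
    rw [min_eq_right hm] at h
    exact absurd (hN.trans hCD) (not_le.2
      (hcon ℓ ⟨hℓ, le_rfl⟩ ℓ ⟨hℓ, le_rfl⟩ (by simp) h N hi))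
  refine ⟨s, hs, ?_⟩
  have hjk : dist (p j) (p k) ≤ 2 * D + 1 := by
    have h1 := dist_triangle4 (p j) (g s) (g u) (p k)
    rw [hg s hs u hu, dist_comm (p j) (g s)] at h1
    linarith
  have h2 := hp.abs_sub_le hR hjk
  have h3 : |(i : ℝ) - j| ≤ |(j : ℝ) - k| := by
    have hji' : (j : ℝ) ≤ i := Nat.cast_le.2 hji
    have hik' : (i : ℝ) ≤ k := Nat.cast_le.2 hik
    rw [abs_of_nonneg (by linarith), abs_of_nonpos (by linarith)]
    linarith
  have h4 := mul_le_mul_of_nonneg_left (h3.trans h2) hR.le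
  have h5 := dist_triangle_right (p i) (g s) (p j)
  linarith [(hp i j).2]

theorem Close.symm {X : Type*} [MetricSpace X] {A B : Set X} (h : Close A B) : Close B A := by
  obtain ⟨R, hR, a, b, ha, hb, hab, hunb⟩ := h
  refine ⟨R, hR, b, a, hb, ha, fun n => by rw [dist_comm]; exact hab n, fun hbd => hunb ?_⟩
  refine (hbd.cthickening (δ := R)).subset ?_
  rintro _ ⟨n, rfl⟩
  exact Metric.mem_cthickening_of_dist_le _ _ _ _ (Set.mem_range_self n) (hab n)

theorem Close.exists_ge {X : Type*} [MetricSpace X] {p q : ℕ → X}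
    (h : Close (Set.range p) (Set.range q)) :
    ∃ C : ℝ, 0 ≤ C ∧ ∀ n : ℕ, ∃ i j, n ≤ i ∧ dist (p i) (q j) ≤ C := by
  obtain ⟨C, hC, a, b, ha, hb, hab, hunb⟩ := h
  refine ⟨C, hC, fun n => ?_⟩
  choose f hf using ha
  choose f' hf' using hb
  by_contra! hcon
  refine hunb (((Set.finite_Iio n).image p).isBounded.subset ?_)
  rintro _ ⟨k, rfl⟩
  refine ⟨f k, ?_, hf k⟩
  by_contra! hk
  have := hcon (f k) (f' k) (not_lt.1 hk)
  rw [hf, hf'] at this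
  exact absurd (hab k) (not_le.2 this)

theorem exists_forall_near_of_close {X : Type*} [MetricSpace X] (hgeo : IsGeodesicSpace X)
    {δ : ℝ} (hδ : 0 ≤ δ) (hX : IsGromovHyperbolic X δ) {p q : ℕ → X} {R S R' S' : ℝ}
    (hR : 0 < R) (hS : 0 ≤ S) (hp : IsQuasigeodesicRay R S p)
    (hR' : 0 < R') (hS' : 0 ≤ S') (hq : IsQuasigeodesicRay R' S' q)
    (hclose : Close (Set.range p) (Set.range q)) :
    ∃ T : ℝ, 0 ≤ T ∧ ∀ n : ℕ, ∃ m : ℕ, dist (p n) (q m) ≤ T := by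
  obtain ⟨C, hC, hpq⟩ := hclose.exists_ge
  have hC' : 0 ≤ max C (dist (p 0) (q 0)) := hC.trans (le_max_left _ _)
  obtain ⟨T₁, hT₁, h₁⟩ := exists_forall_quasigeodesic_near_geodesic hδ hX hR hS (le_refl (0 : ℝ))
  obtain ⟨T₂, hT₂, h₂⟩ := exists_forall_geodesic_near_quasigeodesic hδ hX hR' hS' hC'
  refine ⟨T₁ + T₂, by positivity, fun n => ?_⟩
  obtain ⟨i, j, hi, hij⟩ := hpq n
  obtain ⟨g, hg0, hg1, hg⟩ := hgeo (p 0) (p i)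
  obtain ⟨t, ht, htn⟩ := h₁ g _ p i dist_nonneg hg hp (by simp [hg0]) (by simp [hg1]) n hi
  obtain ⟨m, -, hm⟩ := h₂ g _ q j dist_nonneg hg hq (by rw [hg0]; exact le_max_right _ _)
    (by rw [hg1]; exact hij.trans (le_max_left _ _)) t ht
  exact ⟨m, (dist_triangle _ (g t) _).trans (add_le_add htn hm)⟩

/-- close quasigeodesic rays in a proper geodesic hyperbolic space have
images at finite Hausdorff distance. -/
theorem quasigeodesic_close_hausdorff {X : Type*} [MetricSpace X] [ProperSpace X]
    (hgeo : IsGeodesicSpace X) (δ : ℝ) (hδ : 0 ≤ δ)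
    (hhyp : ∀ w x y z : X,
      gromovProd w x y ≥ min (gromovProd w x z) (gromovProd w z y) - δ)
    (γ γ' : ℕ → X)
    (hγ : ∃ R > (0:ℝ), ∃ S ≥ (0:ℝ), ∀ i j : ℕ,
      |(i:ℝ) - (j:ℝ)| / R - S ≤ dist (γ i) (γ j) ∧
      dist (γ i) (γ j) ≤ R * |(i:ℝ) - (j:ℝ)| + S)
    (hγ' : ∃ R > (0:ℝ), ∃ S ≥ (0:ℝ), ∀ i j : ℕ,
      |(i:ℝ) - (j:ℝ)| / R - S ≤ dist (γ' i) (γ' j) ∧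
      dist (γ' i) (γ' j) ≤ R * |(i:ℝ) - (j:ℝ)| + S)
    (hclose : Close (Set.range γ) (Set.range γ')) :
    ∃ T ≥ (0:ℝ), (∀ n : ℕ, ∃ m : ℕ, dist (γ n) (γ' m) ≤ T) ∧
      (∀ m : ℕ, ∃ n : ℕ, dist (γ' m) (γ n) ≤ T) := by
  obtain ⟨R, hR, S, hS, hp⟩ := hγ
  obtain ⟨R', hR', S', hS', hq⟩ := hγ'
  obtain ⟨T₁, hT₁, h₁⟩ := exists_forall_near_of_close hgeo hδ hhyp hR hS hp hR' hS' hq hclose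
  obtain ⟨T₂, hT₂, h₂⟩ :=
    exists_forall_near_of_close hgeo hδ hhyp hR' hS' hq hR hS hp hclose.symm
  refine ⟨max T₁ T₂, hT₁.trans (le_max_left _ _), fun n => ?_, fun m => ?_⟩
  · obtain ⟨m, hm⟩ := h₁ n
    exact ⟨m, hm.trans (le_max_left _ _)⟩
  · obtain ⟨n, hn⟩ := h₂ m
    exact ⟨n, hn.trans (le_max_right _ _)⟩
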